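/- There exists a constant K₁ > 1 such that for every τ ∈ (0,1) and every 𝐚 ∈ Z̄(τ), one has K₁⁻¹·τ ≤ Υ_𝐚 ≤ K₁·τ. -/

import Mathlib

open MeasureTheory

/-- `SL(2,ℝ)`. -/
abbrev SL2 : Type := Matrix.SpecialLinearGroup (Fin 2) ℝ

/-- The Möbius transformation of `g ∈ SL(2,ℝ)` acting on `ℂ` (junk at the pole). -/
noncomputable def mobiusC (g : SL2) (z : ℂ) : ℂ :=
  ((g.1 0 0 : ℂ) * z + (g.1 0 1 : ℂ)) / ((g.1 1 0 : ℂ) * z + (g.1 1 1 : ℂ))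

/-- The Möbius transformation of `g ∈ SL(2,ℝ)` acting on `ℝ` (junk at the pole). -/
noncomputable def mobiusR (g : SL2) (x : ℝ) : ℝ :=
  (g.1 0 0 * x + g.1 0 1) / (g.1 1 0 * x + g.1 1 1)

/-- The derivative `γ'(z) = (uz+v)⁻²` of the Möbius transformation of `g`. -/
noncomputable def mobiusDerivC (g : SL2) (z : ℂ) : ℂ :=
  ((g.1 1 0 : ℂ) * z + (g.1 1 1 : ℂ))⁻¹ ^ 2

/-- The derivative `γ'(x) = (ux+v)⁻²` of the Möbius transformation of `g`, real version. -/
noncomputable def mobiusDerivR (g : SL2) (x : ℝ) : ℝ :=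
  (g.1 1 0 * x + g.1 1 1)⁻¹ ^ 2

/-- The Möbius transformation of `g ∈ SL(2,ℝ)` acting on the Riemann sphere `ℂ ∪ {∞}`. -/
noncomputable def mobiusS (g : SL2) (z : OnePoint ℂ) : OnePoint ℂ :=
  Option.elim z
    (if (g.1 1 0 : ℝ) = 0 then OnePoint.infty else (((g.1 0 0 / g.1 1 0 : ℝ) : ℂ) : OnePoint ℂ))
    (fun w => if ((g.1 1 0 : ℂ) * w + (g.1 1 1 : ℂ)) = 0 then OnePoint.infty
      else ((mobiusC g w : ℂ) : OnePoint ℂ))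

/-- The involution `a ↦ ā = a + r mod 2r` on the alphabet `𝒜 = Fin (2r)`. -/
def wordBar {r : ℕ} (a : Fin (2 * r)) : Fin (2 * r) :=
  ⟨(a.1 + r) % (2 * r), Nat.mod_lt _ (Nat.lt_of_le_of_lt (Nat.zero_le _) a.isLt)⟩

/-- A word: a finite sequence of letters with no adjacent letter equal to the bar of the
previous one. -/
def IsWord {r : ℕ} (w : List (Fin (2 * r))) : Prop :=
  w.Chain' (fun x y => x ≠ wordBar y)

/-- The mirror word `𝐚̄ = (ā_n, …, ā_1)`. -/
def mirror {r : ℕ} (w : List (Fin (2 * r))) : List (Fin (2 * r)) :=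
  (w.map wordBar).reverse

/-- `𝐚 → 𝐛` : either word is empty, or the last letter of `𝐚` is not the bar of the first
letter of `𝐛`. -/
def arrow {r : ℕ} (w v : List (Fin (2 * r))) : Prop :=
  ∀ x ∈ w.getLast?, ∀ y ∈ v.head?, x ≠ wordBar y

/-- `𝐚 ⇝ 𝐛` : both words are nonempty and the last letter of `𝐚` equals the first letter
of `𝐛`. -/
def wiggly {r : ℕ} (w v : List (Fin (2 * r))) : Prop :=
  w ≠ [] ∧ v ≠ [] ∧ w.getLast? = v.head?

/-- Schottky data: pairwise disjoint closed discs centered on the real line, paired by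
elements of `SL(2,ℝ)`. -/
structure Schottky where
  r : ℕ
  two_le_r : 2 ≤ r
  center : Fin (2 * r) → ℝ
  radius : Fin (2 * r) → ℝ
  radius_pos : ∀ a, 0 < radius a
  g : Fin (2 * r) → SL2
  disjoint : ∀ a b : Fin (2 * r), a ≠ b →
    Disjoint (closure (Metric.ball ((center a : ℂ)) (radius a)))
             (closure (Metric.ball ((center b : ℂ)) (radius b)))
  g_bar : ∀ a : Fin (2 * r), g (wordBar a) = (g a)⁻¹
  maps : ∀ a : Fin (2 * r),
    mobiusS (g a) '' (((fun w : ℂ => (w : OnePoint ℂ)) ''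
        Metric.ball ((center (wordBar a) : ℂ)) (radius (wordBar a)))ᶜ)
      = (fun w : ℂ => (w : OnePoint ℂ)) '' closure (Metric.ball ((center a : ℂ)) (radius a))

namespace Schottky

variable (S : Schottky)

/-- The open disc `D_a`. -/
def D (a : Fin (2 * S.r)) : Set ℂ := Metric.ball ((S.center a : ℂ)) (S.radius a)

/-- The union `𝐃` of the open discs. -/
def Dall : Set ℂ := ⋃ a, S.D a

/-- The open interval `I_a = D_a ∩ ℝ`. -/
def Ireal (a : Fin (2 * S.r)) : Set ℝ := {x : ℝ | (x : ℂ) ∈ S.D a}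

/-- The union `I` of the intervals `I_a`. -/
def Iall : Set ℝ := ⋃ a, S.Ireal a

/-- The group element `γ_𝐚 = γ_{a₁} ⋯ γ_{a_n}` associated to a word. -/
noncomputable def wprod (w : List (Fin (2 * S.r))) : SL2 := (w.map S.g).prod

/-- The Schottky group `Γ`, generated by the `γ_a`. -/
def SGroup : Subgroup SL2 := Subgroup.closure (Set.range S.g)

theorem wprod_mem (w : List (Fin (2 * S.r))) : S.wprod w ∈ S.SGroup := by
  apply Subgroup.list_prod_mem
  intro x hx
  obtain ⟨a, -, rfl⟩ := List.mem_map.mp hx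
  exact Subgroup.subset_closure ⟨a, rfl⟩

/-- `γ_𝐚` as an element of the Schottky group `Γ`. -/
noncomputable def wprodG (w : List (Fin (2 * S.r))) : S.SGroup := ⟨S.wprod w, S.wprod_mem w⟩

/-- The generator `γ_a` as an element of `Γ`. -/
noncomputable def genG (a : Fin (2 * S.r)) : S.SGroup :=
  ⟨S.g a, Subgroup.subset_closure ⟨a, rfl⟩⟩

/-- The interval `I_𝐚 = γ_{𝐚'}(I_{a_n})` of a nonempty word. -/
noncomputable def Iset (w : List (Fin (2 * S.r))) : Set ℝ :=
  if h : w = [] then ∅ else mobiusR (S.wprod w.dropLast) '' S.Ireal (w.getLast h)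

/-- `Υ_𝐚 = |I_𝐚|`, the length of the interval `I_𝐚`; `Υ_∅ = 1`. -/
noncomputable def ups (w : List (Fin (2 * S.r))) : ℝ :=
  if w = [] then 1 else (volume (S.Iset w)).toReal

/-- The Bourgain–Dyatlov partition `Z(τ)`. -/
def Zset (τ : ℝ) : Set (List (Fin (2 * S.r))) :=
  {w | IsWord w ∧ w ≠ [] ∧ S.ups w ≤ τ ∧ τ < S.ups w.dropLast}

/-- The mirror set `Z̄(τ) = {𝐚 ∈ 𝒲 : 𝐚̄ ∈ Z(τ)}`. -/
def Zbar (τ : ℝ) : Set (List (Fin (2 * S.r))) :=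
  {w | IsWord w ∧ mirror w ∈ S.Zset τ}

open Classical in
/-- The Bowen–Series map on the Riemann sphere (junk value `∞` off `𝐃`). -/
noncomputable def TS (z : OnePoint ℂ) : OnePoint ℂ :=
  if h : ∃ a : Fin (2 * S.r), ∃ w : ℂ, z = (w : OnePoint ℂ) ∧ w ∈ S.D a
  then mobiusS (S.g h.choose)⁻¹ z
  else OnePoint.infty

/-- The limit set `Λ`: points of `𝐃` all of whose forward iterates under the Bowen–Series
map are defined (finite) and remain in `𝐃`. -/
def limitSet : Set ℂ :=
  {z : ℂ | ∀ n : ℕ, ∃ w : ℂ, (S.TS)^[n] (z : OnePoint ℂ) = (w : OnePoint ℂ) ∧ w ∈ S.Dall}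

/-- The limit set, viewed inside `ℝ`. -/
def limitSetR : Set ℝ := {x : ℝ | (x : ℂ) ∈ S.limitSet}

/-- `δ`, the Hausdorff dimension of the limit set. -/
noncomputable def delta : ℝ := (dimH S.limitSet).toReal

/-- `PowerPairs(τ)`: pairs `(𝐚,𝐛) ∈ Z̄(τ)²` such that `γ_{𝐚'}γ_{𝐛'}⁻¹` is a nontrivial
proper power in `Γ`. -/
def PowerPairs (τ : ℝ) : Set (List (Fin (2 * S.r)) × List (Fin (2 * S.r))) :=
  {p | p.1 ∈ S.Zbar τ ∧ p.2 ∈ S.Zbar τ ∧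
    S.wprod p.1.dropLast * (S.wprod p.2.dropLast)⁻¹ ≠ 1 ∧
    ∃ γ₀ ∈ S.SGroup, ∃ q : ℕ, 2 ≤ q ∧
      S.wprod p.1.dropLast * (S.wprod p.2.dropLast)⁻¹ = (γ₀ : SL2) ^ q}

end Schottky

theorem wordBar_wordBar {r : ℕ} (a : Fin (2 * r)) : wordBar (wordBar a) = a := by
  have ha := a.isLt
  apply Fin.ext
  simp only [wordBar, Nat.mod_add_mod]
  rw [show a.1 + r + r = a.1 + 2 * r by ring, Nat.add_mod_right, Nat.mod_eq_of_lt ha]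

theorem IsWord.ne_bar {r : ℕ} {l : List (Fin (2 * r))} {x y : Fin (2 * r)}
    (h : IsWord (l ++ [y] ++ [x])) : x ≠ wordBar y := by
  have := (List.isChain_append.1 h).2.2 y (by simp) x (by simp)
  rintro rfl
  exact this (wordBar_wordBar y).symm

theorem IsWord.of_concat {r : ℕ} {l : List (Fin (2 * r))} {x : Fin (2 * r)}
    (h : IsWord (l ++ [x])) : IsWord l :=
  (List.isChain_append.1 h).1

theorem mirror_eq_nil {r : ℕ} {w : List (Fin (2 * r))} : mirror w = [] ↔ w = [] := by
  simp [mirror]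

theorem mobiusR_sub {g : SL2} {x y : ℝ} (hx : g.1 1 0 * x + g.1 1 1 ≠ 0)
    (hy : g.1 1 0 * y + g.1 1 1 ≠ 0) :
    mobiusR g y - mobiusR g x =
      (y - x) / ((g.1 1 0 * x + g.1 1 1) * (g.1 1 0 * y + g.1 1 1)) := by
  have hdet := Matrix.det_fin_two g.1
  rw [g.2] at hdet
  unfold mobiusR
  rw [div_sub_div _ _ hy hx, div_eq_div_iff (mul_ne_zero hy hx) (mul_ne_zero hx hy)]
  linear_combination -(y - x) * (g.1 1 0 * x + g.1 1 1) * (g.1 1 0 * y + g.1 1 1) * hdet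

/-- A Möbius transformation is increasing on an interval that avoids its pole. -/
theorem mobiusR_image_Ioo {g : SL2} {x y : ℝ} (hxy : x < y)
    (hpos : ∀ s ∈ Set.Icc x y, ∀ t ∈ Set.Icc x y,
      0 < (g.1 1 0 * s + g.1 1 1) * (g.1 1 0 * t + g.1 1 1)) :
    mobiusR g '' Set.Ioo x y = Set.Ioo (mobiusR g x) (mobiusR g y) := by
  have hne : ∀ s ∈ Set.Icc x y, g.1 1 0 * s + g.1 1 1 ≠ 0 := fun s hs =>
    left_ne_zero_of_mul (hpos s hs s hs).ne'
  have hmono : StrictMonoOn (mobiusR g) (Set.Icc x y) := fun s hs t ht hst => by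
    rw [← sub_pos, mobiusR_sub (hne s hs) (hne t ht)]
    exact div_pos (sub_pos.2 hst) (hpos s hs t ht)
  apply Set.Subset.antisymm
  · rintro _ ⟨s, hs, rfl⟩
    have hs' := Set.Ioo_subset_Icc_self hs
    exact ⟨hmono (Set.left_mem_Icc.2 hxy.le) hs' hs.1,
      hmono hs' (Set.right_mem_Icc.2 hxy.le) hs.2⟩
  · refine intermediate_value_Ioo hxy.le (ContinuousOn.div ?_ ?_ hne) <;> fun_prop

theorem Finite.exists_abs_le {ι : Type*} [Finite ι] (f : ι → ℝ) : ∃ L, ∀ i, |f i| ≤ L := by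
  obtain ⟨L, hL⟩ := Set.Finite.bddAbove (Set.finite_range fun i => |f i|)
  exact ⟨L, fun i => hL ⟨i, rfl⟩⟩

namespace Schottky

variable (S : Schottky)

/-- The closure of `I_a`, a compact real interval. -/
def closedI (a : Fin (2 * S.r)) : Set ℝ :=
  Set.Icc (S.center a - S.radius a) (S.center a + S.radius a)

variable {S}

theorem Ireal_eq (a : Fin (2 * S.r)) :
    S.Ireal a = Set.Ioo (S.center a - S.radius a) (S.center a + S.radius a) := by
  ext x
  rw [← Real.ball_eq_Ioo]
  simp only [Ireal, D, Set.mem_ofPred_eq, Metric.mem_ball, Complex.dist_eq, ← Complex.ofReal_sub,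
    Complex.norm_real, Real.dist_eq, Real.norm_eq_abs]

theorem ofReal_mem_closure_D_iff {a : Fin (2 * S.r)} {x : ℝ} :
    (x : ℂ) ∈ closure (Metric.ball ((S.center a : ℂ)) (S.radius a)) ↔ x ∈ S.closedI a := by
  rw [closure_ball _ (S.radius_pos a).ne', closedI, ← Real.closedBall_eq_Icc]
  simp only [Metric.mem_closedBall, Complex.dist_eq, ← Complex.ofReal_sub,
    Complex.norm_real, Real.dist_eq, Real.norm_eq_abs]

theorem radius_add_lt {a b : Fin (2 * S.r)} (hab : a ≠ b) :
    S.radius a + S.radius b < |S.center a - S.center b| := by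
  have hd : Disjoint (S.closedI a) (S.closedI b) := Set.disjoint_left.2 fun x hxa hxb =>
    Set.disjoint_left.1 (S.disjoint a b hab) (ofReal_mem_closure_D_iff.2 hxa)
      (ofReal_mem_closure_D_iff.2 hxb)
  have ha := S.radius_pos a
  have hb := S.radius_pos b
  by_contra! h
  rw [abs_le] at h
  refine hd.notMem_of_mem_left
    (a := max (S.center a - S.radius a) (S.center b - S.radius b)) ?_ ?_ <;>
  · refine ⟨by simp, ?_⟩
    rw [max_le_iff]
    constructor <;> linarith

/-- Points of the closures of two distinct intervals are at distance bounded above and below. -/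
theorem exists_abs_log_sub_le (S : Schottky) :
    ∃ L, ∀ a b : Fin (2 * S.r), a ≠ b → ∀ x ∈ S.closedI a, ∀ y ∈ S.closedI b,
      |Real.log (x - y)| ≤ L := by
  obtain ⟨L₁, h₁⟩ := Finite.exists_abs_le fun p : Fin (2 * S.r) × Fin (2 * S.r) =>
    Real.log (|S.center p.1 - S.center p.2| - (S.radius p.1 + S.radius p.2))
  obtain ⟨L₂, h₂⟩ := Finite.exists_abs_le fun p : Fin (2 * S.r) × Fin (2 * S.r) =>
    Real.log (|S.center p.1 - S.center p.2| + (S.radius p.1 + S.radius p.2))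
  refine ⟨max L₁ L₂, fun a b hab x hx y hy => ?_⟩
  have hlt := radius_add_lt hab
  have hx' : |x - S.center a| ≤ S.radius a := by
    rw [abs_le]; constructor <;> linarith [hx.1, hx.2]
  have hy' : |y - S.center b| ≤ S.radius b := by
    rw [abs_le]; constructor <;> linarith [hy.1, hy.2]
  have e : |(x - y) - (S.center a - S.center b)| ≤ S.radius a + S.radius b := by
    rw [show (x - y) - (S.center a - S.center b) = (x - S.center a) - (y - S.center b) by ring]
    exact (abs_sub _ _).trans (add_le_add hx' hy')
  have e₁ := abs_sub_abs_le_abs_sub (x - y) (S.center a - S.center b)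
  have e₂ := abs_sub_abs_le_abs_sub (S.center a - S.center b) (x - y)
  rw [abs_sub_comm (S.center a - S.center b)] at e₂
  have l₁ := Real.log_le_log (sub_pos.2 hlt) (show _ ≤ |x - y| by linarith)
  have l₂ := Real.log_le_log (show 0 < |x - y| by linarith)
    (show _ ≤ |S.center a - S.center b| + (S.radius a + S.radius b) by linarith)
  rw [Real.log_abs] at l₁ l₂
  have k₁ := neg_le_of_abs_le (h₁ (a, b))
  have k₂ := le_of_abs_le (h₂ (a, b))
  rw [abs_le]
  constructor <;> linarith [le_max_left L₁ L₂, le_max_right L₁ L₂]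

theorem g_infty (a : Fin (2 * S.r)) :
    (S.g a).1 1 0 ≠ 0 ∧ (S.g a).1 0 0 / (S.g a).1 1 0 ∈ S.closedI a := by
  have h : mobiusS (S.g a) OnePoint.infty ∈ (fun w : ℂ => (w : OnePoint ℂ)) ''
      closure (Metric.ball ((S.center a : ℂ)) (S.radius a)) := by
    rw [← S.maps a]
    exact ⟨_, by simp, rfl⟩
  obtain ⟨w, hw, h⟩ := h
  change (w : OnePoint ℂ) = if (S.g a).1 1 0 = 0 then OnePoint.infty else _ at h
  split_ifs at h with hc
  · exact absurd h (OnePoint.coe_ne_infty w)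
  · rw [OnePoint.coe_eq_coe] at h
    exact ⟨hc, ofReal_mem_closure_D_iff.1 (h ▸ hw)⟩

theorem g_apply {a : Fin (2 * S.r)} {x : ℝ} (hx : x ∉ S.closedI (wordBar a)) :
    mobiusR (S.g a) x ∈ S.closedI a := by
  have h : mobiusS (S.g a) ((x : ℂ) : OnePoint ℂ) ∈ (fun w : ℂ => (w : OnePoint ℂ)) ''
      closure (Metric.ball ((S.center a : ℂ)) (S.radius a)) := by
    rw [← S.maps a]
    refine ⟨_, ?_, rfl⟩
    rintro ⟨w, hw, h⟩
    rw [OnePoint.coe_eq_coe] at h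
    exact hx (ofReal_mem_closure_D_iff.1 (subset_closure (h ▸ hw)))
  obtain ⟨w, hw, h⟩ := h
  change (w : OnePoint ℂ) = if ((S.g a).1 1 0 : ℂ) * x + (S.g a).1 1 1 = 0
    then OnePoint.infty else _ at h
  split_ifs at h with hc
  · exact absurd h (OnePoint.coe_ne_infty w)
  · rw [OnePoint.coe_eq_coe] at h
    rw [← ofReal_mem_closure_D_iff]
    convert hw using 1
    rw [h]
    simp [mobiusR, mobiusC]

theorem notMem_closedI {a b : Fin (2 * S.r)} (hab : a ≠ b) {x : ℝ} (hx : x ∈ S.closedI a) :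
    x ∉ S.closedI b := fun hxb =>
  Set.disjoint_left.1 (S.disjoint a b hab) (ofReal_mem_closure_D_iff.2 hx)
    (ofReal_mem_closure_D_iff.2 hxb)

variable (S) in
/-- The pole `γ_𝐚⁻¹(∞)`. -/
noncomputable def pole (w : List (Fin (2 * S.r))) : ℝ :=
  -(S.wprod w).1 1 1 / (S.wprod w).1 1 0

theorem wprod_concat (l : List (Fin (2 * S.r))) (x : Fin (2 * S.r)) :
    S.wprod (l ++ [x]) = S.wprod l * S.g x := by
  simp [wprod]

theorem wprod_concat_lower_left {l : List (Fin (2 * S.r))} (x : Fin (2 * S.r))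
    (hl : (S.wprod l).1 1 0 ≠ 0) :
    (S.wprod (l ++ [x])).1 1 0 = (S.wprod l).1 1 0 *
      ((S.g x).1 1 0 * ((S.g x).1 0 0 / (S.g x).1 1 0 - S.pole l)) := by
  have hx := (g_infty x).1
  rw [wprod_concat, Matrix.SpecialLinearGroup.coe_mul, Matrix.mul_apply, Fin.sum_univ_two, pole]
  field_simp
  ring

theorem pole_mem (l : List (Fin (2 * S.r))) : ∀ x, IsWord (l ++ [x]) →
    (S.wprod (l ++ [x])).1 1 0 ≠ 0 ∧ S.pole (l ++ [x]) ∈ S.closedI (wordBar x) := by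
  induction l using List.reverseRecOn with
  | nil =>
    intro x _
    have h := (g_infty x).1
    have h' := (g_infty (wordBar x)).2
    simp only [S.g_bar, Matrix.SpecialLinearGroup.coe_inv, Matrix.adjugate_fin_two] at h'
    refine ⟨by simpa [wprod] using h, ?_⟩
    convert h' using 1
    simp [pole, wprod, neg_div, div_neg]
  | append_singleton l y ih =>
    intro x hw
    obtain ⟨hc, hp⟩ := ih y hw.of_concat
    have hne := hw.ne_bar
    have hx := g_infty x
    have hsub : (S.g x).1 0 0 / (S.g x).1 1 0 - S.pole (l ++ [y]) ≠ 0 := fun h =>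
      notMem_closedI hne hx.2 (sub_eq_zero.1 h ▸ hp)
    have hcx : (S.wprod (l ++ [y] ++ [x])).1 1 0 ≠ 0 := by
      rw [wprod_concat_lower_left x hc]
      exact mul_ne_zero hc (mul_ne_zero hx.1 hsub)
    refine ⟨hcx, ?_⟩
    have h' := g_apply (S := S) (a := wordBar x) (x := S.pole (l ++ [y]))
      (by rw [wordBar_wordBar]; exact notMem_closedI hne.symm hp)
    convert h' using 1
    have hden : (S.g x).1 0 0 - (S.g x).1 1 0 * S.pole (l ++ [y]) ≠ 0 := by
      have := mul_ne_zero hx.1 hsub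
      rwa [mul_sub, mul_div_cancel₀ _ hx.1] at this
    have hd : (S.wprod (l ++ [y])).1 1 1 =
        -(S.wprod (l ++ [y])).1 1 0 * S.pole (l ++ [y]) := by
      rw [pole]; field_simp
    rw [S.g_bar, mobiusR, pole]
    simp only [Matrix.SpecialLinearGroup.coe_inv, Matrix.adjugate_fin_two, wprod_concat _ x,
      Matrix.SpecialLinearGroup.coe_mul, Matrix.mul_apply, Fin.sum_univ_two, hd, Matrix.of_apply,
      Matrix.cons_val_zero, Matrix.cons_val_one, Matrix.cons_val', Matrix.cons_val_fin_one]
    generalize S.pole (l ++ [y]) = p at *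
    rw [div_eq_div_iff]
    · ring
    · convert mul_ne_zero hc hden using 1; ring
    · convert hden using 1; ring

theorem ups_singleton (x : Fin (2 * S.r)) : S.ups [x] = 2 * S.radius x := by
  have h : mobiusR 1 = id := by ext t; simp [mobiusR]
  have hr := S.radius_pos x
  simp [ups, Iset, wprod, h, Ireal_eq, Real.volume_Ioo]
  ring_nf
  rw [ENNReal.toReal_ofReal (by linarith)]

theorem ups_concat {l : List (Fin (2 * S.r))} {x y : Fin (2 * S.r)}
    (hw : IsWord (l ++ [y] ++ [x])) :
    S.ups (l ++ [y] ++ [x]) = 2 * S.radius x / ((S.wprod (l ++ [y])).1 1 0 ^ 2 *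
      ((S.center x - S.radius x - S.pole (l ++ [y])) *
        (S.center x + S.radius x - S.pole (l ++ [y])))) := by
  obtain ⟨hc, hp⟩ := pole_mem l y hw.of_concat
  have hr := S.radius_pos x
  have hpx := notMem_closedI hw.ne_bar.symm hp
  have hlin : ∀ t, (S.wprod (l ++ [y])).1 1 0 * t + (S.wprod (l ++ [y])).1 1 1 =
      (S.wprod (l ++ [y])).1 1 0 * (t - S.pole (l ++ [y])) := by
    intro t; rw [pole]; field_simp; ring
  have hpos : ∀ s ∈ S.closedI x, ∀ t ∈ S.closedI x,
      0 < ((S.wprod (l ++ [y])).1 1 0 * s + (S.wprod (l ++ [y])).1 1 1) *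
        ((S.wprod (l ++ [y])).1 1 0 * t + (S.wprod (l ++ [y])).1 1 1) := by
    intro s hs t ht
    rw [hlin, hlin, mul_mul_mul_comm]
    refine mul_pos (mul_self_pos.2 hc) ?_
    by_cases h : S.pole (l ++ [y]) < S.center x - S.radius x
    · exact mul_pos (by linarith [hs.1]) (by linarith [ht.1])
    · have h' : S.center x + S.radius x < S.pole (l ++ [y]) := by
        by_contra! h'
        exact hpx ⟨not_lt.1 h, h'⟩
      exact mul_pos_of_neg_of_neg (by linarith [hs.2]) (by linarith [ht.2])
  have hI : S.Iset (l ++ [y] ++ [x]) = mobiusR (S.wprod (l ++ [y])) '' S.Ireal x := by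
    rw [Iset, dif_neg (by simp)]
    rw [List.dropLast_concat, List.getLast_concat]
  have hleft : S.center x - S.radius x ∈ S.closedI x := ⟨le_rfl, by linarith⟩
  have hright : S.center x + S.radius x ∈ S.closedI x := ⟨by linarith, le_rfl⟩
  have hlr := hpos _ hleft _ hright
  rw [ups, if_neg (by simp), hI, Ireal_eq, mobiusR_image_Ioo (by linarith) hpos, Real.volume_Ioo,
    mobiusR_sub (left_ne_zero_of_mul hlr.ne') (right_ne_zero_of_mul hlr.ne'),
    ENNReal.toReal_ofReal (div_nonneg (by linarith) hlr.le), hlin, hlin]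
  congr 1 <;> ring

theorem wprod_mirror (w : List (Fin (2 * S.r))) : S.wprod (mirror w) = (S.wprod w)⁻¹ := by
  induction w with
  | nil => simp [wprod, mirror]
  | cons x l ih =>
    have h : mirror (x :: l) = mirror l ++ [wordBar x] := by simp [mirror]
    rw [h, wprod_concat, ih, S.g_bar]
    simp [wprod]

theorem log_wprod_mirror (w : List (Fin (2 * S.r))) :
    Real.log ((S.wprod (mirror w)).1 1 0) = Real.log ((S.wprod w).1 1 0) := by
  rw [wprod_mirror]
  simp [Matrix.SpecialLinearGroup.coe_inv, Matrix.adjugate_fin_two]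

theorem ups_pos {w : List (Fin (2 * S.r))} (hw : IsWord w) : 0 < S.ups w := by
  induction w using List.reverseRecOn with
  | nil => simp [ups]
  | append_singleton l x _ =>
    have hr := S.radius_pos x
    induction l using List.reverseRecOn with
    | nil => rw [List.nil_append, ups_singleton]; linarith
    | append_singleton l y _ =>
      obtain ⟨hc, hp⟩ := pole_mem l y hw.of_concat
      have hpx := notMem_closedI hw.ne_bar.symm hp
      rw [ups_concat hw]
      refine div_pos (by linarith) (mul_pos (by positivity) ?_)
      by_cases h : S.pole (l ++ [y]) < S.center x - S.radius x
      · exact mul_pos (by linarith) (by linarith)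
      · have h' : S.center x + S.radius x < S.pole (l ++ [y]) := by
          by_contra! h'
          exact hpx ⟨not_lt.1 h, h'⟩
        exact mul_pos_of_neg_of_neg (by linarith) (by linarith)

/-- `Υ_𝐚` is comparable to `u⁻²`, where `u` is the lower left entry of `γ_𝐚`, and to the value of `Υ`
at the word with its last letter removed. -/
theorem exists_log_ups_bounds (S : Schottky) : ∃ L, 0 ≤ L ∧
    ∀ w : List (Fin (2 * S.r)), IsWord w → w ≠ [] →
      |Real.log (S.ups w) + 2 * Real.log ((S.wprod w).1 1 0)| ≤ L ∧
      |Real.log (S.ups w) - Real.log (S.ups w.dropLast)| ≤ L := by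
  obtain ⟨L₁, h₁⟩ := exists_abs_log_sub_le S
  obtain ⟨L₂, h₂⟩ := Finite.exists_abs_le fun a => Real.log (2 * S.radius a)
  obtain ⟨L₃, h₃⟩ := Finite.exists_abs_le fun a => Real.log ((S.g a).1 1 0)
  set L := max (max L₁ L₂) (max L₃ 0) with hL
  have b₁ : L₁ ≤ L := by simp [hL]
  have b₂ : L₂ ≤ L := by simp [hL]
  have b₃ : L₃ ≤ L := by simp [hL]
  have b₀ : 0 ≤ L := by simp [hL]
  have key : ∀ (l : List (Fin (2 * S.r))) (x : Fin (2 * S.r)), IsWord (l ++ [x]) →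
      |Real.log (S.ups (l ++ [x])) + 2 * Real.log ((S.wprod (l ++ [x])).1 1 0)| ≤ 7 * L ∧
      (l ≠ [] → |Real.log ((S.wprod (l ++ [x])).1 1 0) - Real.log ((S.wprod l).1 1 0)|
        ≤ 2 * L) := by
    intro l x hw
    have hr := S.radius_pos x
    have k₂ := abs_le.1 ((h₂ x).trans b₂)
    have k₃ := abs_le.1 ((h₃ x).trans b₃)
    induction l using List.reverseRecOn with
    | nil =>
      refine ⟨?_, fun h => absurd rfl h⟩
      rw [List.nil_append, ups_singleton]
      simp only [wprod, List.map_cons, List.map_nil, List.prod_cons, List.prod_nil, mul_one]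
      rw [abs_le]
      constructor <;> linarith
    | append_singleton l y _ =>
      obtain ⟨hc, hp⟩ := pole_mem l y hw.of_concat
      have hx := g_infty x
      have hne := hw.ne_bar
      have hsub : ∀ t ∈ S.closedI x, t - S.pole (l ++ [y]) ≠ 0 := fun t ht h =>
        notMem_closedI hne ht (sub_eq_zero.1 h ▸ hp)
      have hleft : S.center x - S.radius x ∈ S.closedI x := ⟨le_rfl, by linarith⟩
      have hright : S.center x + S.radius x ∈ S.closedI x := ⟨by linarith, le_rfl⟩
      have n₀ := hsub _ hx.2
      have n₁ := hsub _ hleft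
      have n₂ := hsub _ hright
      have d₀ := abs_le.1 ((h₁ _ _ hne _ hx.2 _ hp).trans b₁)
      have d₁ := abs_le.1 ((h₁ _ _ hne _ hleft _ hp).trans b₁)
      have d₂ := abs_le.1 ((h₁ _ _ hne _ hright _ hp).trans b₁)
      have e₁ := congrArg Real.log (wprod_concat_lower_left x hc)
      rw [Real.log_mul hc (mul_ne_zero hx.1 n₀), Real.log_mul hx.1 n₀] at e₁
      have e₂ := congrArg Real.log (ups_concat hw)
      rw [Real.log_div (by positivity) (mul_ne_zero (pow_ne_zero 2 hc) (mul_ne_zero n₁ n₂)),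
        Real.log_mul (pow_ne_zero 2 hc) (mul_ne_zero n₁ n₂), Real.log_mul n₁ n₂,
        Real.log_pow] at e₂
      push_cast at e₂
      refine ⟨?_, fun _ => ?_⟩
      · rw [abs_le]; constructor <;> linarith
      · rw [abs_le]; constructor <;> linarith
  refine ⟨18 * L, by linarith, fun w hw hnil => ?_⟩
  obtain ⟨l, x, rfl⟩ := w.eq_nil_or_concat'.resolve_left hnil
  obtain ⟨h, h'⟩ := key l x hw
  refine ⟨h.trans (by linarith), ?_⟩
  rw [List.dropLast_concat]
  obtain rfl | ⟨l, y, rfl⟩ := l.eq_nil_or_concat'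
  · rw [List.nil_append, ups_singleton]
    simp only [ups, if_true, Real.log_one, sub_zero]
    exact (h₂ x).trans (by linarith)
  · have h'' := abs_le.1 (key l y hw.of_concat).1
    have k := abs_le.1 (h' (by simp))
    rw [abs_le] at h ⊢
    constructor <;> linarith

end Schottky

/-- there is `K₁ > 1` with `K₁⁻¹ τ ≤ Υ_𝐚 ≤ K₁ τ` for every `τ ∈ (0,1)`
and every `𝐚 ∈ Z̄(τ)`. -/
theorem stmt_2 (S : Schottky) :
    ∃ K₁ : ℝ, 1 < K₁ ∧
      ∀ τ : ℝ, 0 < τ → τ < 1 →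
        ∀ w ∈ S.Zbar τ, K₁⁻¹ * τ ≤ S.ups w ∧ S.ups w ≤ K₁ * τ := by
  obtain ⟨L, hL, h⟩ := S.exists_log_ups_bounds
  refine ⟨Real.exp (3 * L + 1), Real.one_lt_exp_iff.2 (by linarith), fun τ hτ _ w hw => ?_⟩
  obtain ⟨hword, hmword, hnil, hle, hlt⟩ := hw
  obtain ⟨h₁, -⟩ := h w hword fun hw => hnil (mirror_eq_nil.2 hw)
  obtain ⟨h₂, h₃⟩ := h (mirror w) hmword hnil
  rw [S.log_wprod_mirror] at h₂
  have hlog₁ := Real.log_le_log (Schottky.ups_pos hmword) hle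
  have hlog₂ := Real.log_le_log hτ hlt.le
  have hpos := Schottky.ups_pos hword
  rw [abs_le] at h₁ h₂ h₃
  rw [← Real.exp_neg, ← Real.log_le_log_iff (by positivity) hpos,
    ← Real.log_le_log_iff hpos (by positivity), Real.log_mul (Real.exp_ne_zero _) hτ.ne',
    Real.log_mul (Real.exp_ne_zero _) hτ.ne', Real.log_exp, Real.log_exp]
  constructor <;> linarith
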